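/- arXiv:2010.09536 — 4 statements merged into one kernel-verified Lean document; each statement's English description precedes it below -/
import Mathlib

section
/- Let π₁, π₂ ∈ Π, θ, θ̂ ∈ Θ, γ ∈ [0,1), and L̂ ≥ 0. Assume: (i) f_{θ̂}(π₁) ≤ γ·f_θ(π₁); (ii) |f_{θ̂}(π₁) − f_{θ̂}(π′)| ≤ L̂·d(π₁, π′) for all π′ ∈ Π; (iii) f_θ(π₁) ≤ f_θ(π₂); and (iv) f_θ(π₂) > L̂·d(π₁, π₂) / (1 − γ). Then there exists γ_g ∈ [0,1) such that f_{θ̂}(π₂) ≤ γ_g·f_θ(π₂); in particular f_{θ̂}(π₂) < f_θ(π₂). -/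
/-- **Corollary 1 (paper).** The value approximation update for `π₁` is also a
`γ_g`-contraction for `π₂` (with some `γ_g ∈ [0,1)`) whenever
`f_θ(π₂) > L̂·d(π₁,π₂)/(1-γ)`; in particular `f_{θ̂}(π₂) < f_θ(π₂)`. -/
theorem pevfa_generalization_contraction_condition
    {Pol : Type*} [PseudoMetricSpace Pol] {E : Type*} [NormedAddCommGroup E]
    {Θ : Type*} (V : Pol → E) (𝕍 : Θ → Pol → E)
    (f : Θ → Pol → ℝ) (hf : ∀ θ π, f θ π = ‖𝕍 θ π - V π‖)
    (π₁ π₂ : Pol) (θ θhat : Θ) (γ Lhat : ℝ)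
    (hγ0 : 0 ≤ γ) (hγ1 : γ < 1) (hL : 0 ≤ Lhat)
    (hcontract : f θhat π₁ ≤ γ * f θ π₁)
    (hcont : ∀ π' : Pol, |f θhat π₁ - f θhat π'| ≤ Lhat * dist π₁ π')
    (hle : f θ π₁ ≤ f θ π₂)
    (hgap : f θ π₂ > Lhat * dist π₁ π₂ / (1 - γ)) :
    (∃ γg : ℝ, 0 ≤ γg ∧ γg < 1 ∧ f θhat π₂ ≤ γg * f θ π₂) ∧
      f θhat π₂ < f θ π₂ := by
  have h1γ : 0 < 1 - γ := sub_pos.mpr hγ1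
  have hpos : 0 < f θ π₂ :=
    lt_of_le_of_lt (div_nonneg (mul_nonneg hL dist_nonneg) h1γ.le) hgap
  have hnonneg : 0 ≤ f θhat π₂ := hf θhat π₂ ▸ norm_nonneg _
  have hlt : f θhat π₂ < f θ π₂ := by
    have hdist : Lhat * dist π₁ π₂ < f θ π₂ * (1 - γ) := (div_lt_iff₀ h1γ).mp hgap
    have hlip := (abs_le.mp (hcont π₂)).1
    have hmul := mul_le_mul_of_nonneg_left hle hγ0
    linarith
  exact ⟨⟨f θhat π₂ / f θ π₂, div_nonneg hnonneg hpos.le, (div_lt_one hpos).mpr hlt,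
    (div_mul_cancel₀ _ hpos.ne').ge⟩, hlt⟩
end

section
/- Let π₁, π₂ ∈ Π, θ, θ̂ ∈ Θ, γ ∈ [0,1), and L̂ ≥ 0. Assume: (i) f_{θ̂}(π₁) ≤ γ·f_θ(π₁); (ii) |f_{θ̂}(π₁) − f_{θ̂}(π′)| ≤ L̂·d(π₁, π′) for all π′ ∈ Π; and (iii) f_θ(π₂) − γ·f_θ(π₁) > L̂·d(π₁, π₂). Then f_{θ̂}(π₂) < f_θ(π₂); equivalently, there exists γ_g ∈ [0,1) with f_{θ̂}(π₂) ≤ γ_g·f_θ(π₂). -/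
/-- **Corollary 3 (paper, appendix).** A more general condition for generalization
contraction on `f(π₂)`: if `f_θ(π₂) − γ·f_θ(π₁) > L̂·d(π₁,π₂)`, then
`f_{θ̂}(π₂) < f_θ(π₂)`; equivalently there exists `γ_g ∈ [0,1)` with
`f_{θ̂}(π₂) ≤ γ_g·f_θ(π₂)`. -/
theorem pevfa_general_generalization_contraction_condition
    {Pol : Type*} [PseudoMetricSpace Pol] {E : Type*} [NormedAddCommGroup E]
    {Θ : Type*} (V : Pol → E) (𝕍 : Θ → Pol → E)
    (f : Θ → Pol → ℝ) (hf : ∀ θ π, f θ π = ‖𝕍 θ π - V π‖)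
    (π₁ π₂ : Pol) (θ θhat : Θ) (γ Lhat : ℝ)
    (hγ0 : 0 ≤ γ) (hγ1 : γ < 1) (hL : 0 ≤ Lhat)
    (hcontract : f θhat π₁ ≤ γ * f θ π₁)
    (hcont : ∀ π' : Pol, |f θhat π₁ - f θhat π'| ≤ Lhat * dist π₁ π')
    (hgap : f θ π₂ - γ * f θ π₁ > Lhat * dist π₁ π₂) :
    f θhat π₂ < f θ π₂ ∧
      ∃ γg : ℝ, 0 ≤ γg ∧ γg < 1 ∧ f θhat π₂ ≤ γg * f θ π₂ := by
  have hlt : f θhat π₂ < f θ π₂ := by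
    linarith [(abs_le.mp (hcont π₂)).1]
  have hnonneg : 0 ≤ f θhat π₂ := hf θhat π₂ ▸ norm_nonneg _
  have hpos : 0 < f θ π₂ := hnonneg.trans_lt hlt
  exact ⟨hlt, f θhat π₂ / f θ π₂, div_nonneg hnonneg hpos.le, (div_lt_one hpos).mpr hlt,
    (div_mul_cancel₀ _ hpos.ne').ge⟩
end

section
/- Let π : ℕ → Π be a sequence of policies, θ : ℕ → Θ a sequence of parameters with initial parameter θ_init ∈ Θ, γ : ℕ → [0,1), and L : ℕ → [0,∞). Assume for every t ∈ ℕ: (i) f_{θ 0}(π 0) ≤ γ 0 · f_{θ_init}(π 0), and for t ≥ 1, f_{θ t}(π t) ≤ γ t · f_{θ (t−1)}(π t); and (ii) |f_{θ t}(π t) − f_{θ t}(π′)| ≤ (L t)·d(π t, π′) for all π′ ∈ Π. Define M i = (L i)·d(π i, π (i+1)). Then for every t ∈ ℕ: f_{θ t}(π (t+1)) ≤ (∏_{i=0}^{t} γ i)·f_{θ_init}(π 0) + Σ_{i=0}^{t−1} (∏_{j=i+1}^{t} γ j)·(M i) + M t. -/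
/-- Sums weighted by tail products satisfy a first-order linear recurrence. -/
theorem sum_prod_Icc_mul_succ {R : Type*} [CommSemiring R] (γ M : ℕ → R) (t : ℕ) :
    ∑ i ∈ Finset.range (t + 1), (∏ j ∈ Finset.Icc (i + 1) (t + 1), γ j) * M i =
      γ (t + 1) *
        (∑ i ∈ Finset.range t, (∏ j ∈ Finset.Icc (i + 1) t, γ j) * M i + M t) := by
  rw [Finset.sum_range_succ, mul_add, Finset.mul_sum]
  congr 1
  · refine Finset.sum_congr rfl fun i hi => ?_
    have hit : i + 1 ≤ t + 1 := by
      have := Finset.mem_range.mp hi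
      omega
    rw [Finset.prod_Icc_succ_top hit]
    ring
  · simp

open Finset in
/-- **Corollary 2 (paper).** Along the consecutive value approximation process
`θ_init → θ 0 → θ 1 → ⋯` (each step a `γ t`-contraction for `π t`, with
`f_{θ t}` being `L t`-continuous at `π t`), the generalized approximation loss
satisfies, with `M i = L i · d(π i, π (i+1))`:
`f_{θ t}(π (t+1)) ≤ (∏_{i=0}^t γ i)·f_{θ_init}(π 0)
  + Σ_{i=0}^{t-1} (∏_{j=i+1}^t γ j)·M i + M t`. -/
theorem pevfa_local_generalization_induction
    {Pol : Type*} [PseudoMetricSpace Pol] {E : Type*} [NormedAddCommGroup E]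
    {Θ : Type*} (V : Pol → E) (𝕍 : Θ → Pol → E)
    (f : Θ → Pol → ℝ) (hf : ∀ θ π, f θ π = ‖𝕍 θ π - V π‖)
    (π : ℕ → Pol) (θ : ℕ → Θ) (θinit : Θ) (γ L : ℕ → ℝ)
    (hγ0 : ∀ t, 0 ≤ γ t) (hγ1 : ∀ t, γ t < 1) (hL : ∀ t, 0 ≤ L t)
    (hcontract0 : f (θ 0) (π 0) ≤ γ 0 * f θinit (π 0))
    (hcontract : ∀ t : ℕ, 1 ≤ t → f (θ t) (π t) ≤ γ t * f (θ (t - 1)) (π t))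
    (hcont : ∀ t : ℕ, ∀ π' : Pol,
      |f (θ t) (π t) - f (θ t) π'| ≤ L t * dist (π t) π')
    (M : ℕ → ℝ) (hM : ∀ i, M i = L i * dist (π i) (π (i + 1))) :
    ∀ t : ℕ,
      f (θ t) (π (t + 1)) ≤
        (∏ i ∈ Finset.range (t + 1), γ i) * f θinit (π 0) +
          (∑ i ∈ Finset.range t, (∏ j ∈ Finset.Icc (i + 1) t, γ j) * M i) +
          M t := by
  have hstep (t : ℕ) : f (θ t) (π (t + 1)) ≤ f (θ t) (π t) + M t := by
    linarith [neg_le_of_abs_le (hcont t (π (t + 1))), hM t]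
  intro t
  induction t with
  | zero =>
    simpa using (hstep 0).trans (add_le_add_left hcontract0 (M 0))
  | succ t ih =>
    rw [Finset.prod_range_succ, sum_prod_Icc_mul_succ]
    have hc : f (θ (t + 1)) (π (t + 1)) ≤ γ (t + 1) * f (θ t) (π (t + 1)) :=
      hcontract (t + 1) (Nat.le_add_left 1 t)
    linarith [hstep (t + 1), mul_le_mul_of_nonneg_left ih (hγ0 (t + 1))]
end

section
/- Let π : ℕ → Π, θ : ℕ → Θ, θ_init ∈ Θ, γ : ℕ → [0,1), and L : ℕ → [0,∞). Assume for every t ∈ ℕ: (i) f_{θ 0}(π 0) ≤ γ 0 · f_{θ_init}(π 0), and for t ≥ 1, f_{θ t}(π t) ≤ γ t · f_{θ (t−1)}(π t); (ii) |f_{θ t}(π t) − f_{θ t}(π′)| ≤ (L t)·d(π t, π′) for all π′ ∈ Π. Further assume there exist constants L_max ≥ 0 and D ≥ 0 with L t ≤ L_max and d(π t, π (t+1)) ≤ D for all t, and there exist C > 0 and ε > 0 such that for all natural numbers h₁ ≤ h₂, ∏_{k=h₁}^{h₂} γ k ≤ C / (h₂ − h₁ + 1)^{1+ε}. Then the sequence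 t ↦ f_{θ t}(π (t+1)) is bounded: there exists B < ∞ with f_{θ t}(π (t+1)) ≤ B for all t ∈ ℕ. -/
/-- Iterating `u (n + 1) ≤ γ n * u n + M` yields the discrete Duhamel bound. -/
lemma le_prod_mul_add_sum_prod_of_succ_le {γ u : ℕ → ℝ} {M : ℝ} (hγ : ∀ n, 0 ≤ γ n)
    (hu : ∀ n, u (n + 1) ≤ γ n * u n + M) (n : ℕ) :
    u n ≤ (∏ k ∈ Finset.Ico 0 n, γ k) * u 0
      + M * ∑ j ∈ Finset.range n, ∏ k ∈ Finset.Ico (j + 1) n, γ k := by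
  induction n with
  | zero => simp
  | succ n ih =>
    have hsum : ∑ j ∈ Finset.range n, ∏ k ∈ Finset.Ico (j + 1) (n + 1), γ k
        = (∑ j ∈ Finset.range n, ∏ k ∈ Finset.Ico (j + 1) n, γ k) * γ n := by
      rw [Finset.sum_mul]
      refine Finset.sum_congr rfl fun j hj => ?_
      exact Finset.prod_Ico_succ_top (Finset.mem_range.1 hj) _
    rw [Finset.sum_range_succ, hsum, Finset.prod_Ico_succ_top (Nat.zero_le n),
      Finset.Ico_self, Finset.prod_empty]
    linarith [hu n, mul_le_mul_of_nonneg_left ih (hγ n)]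

/-- A perturbed linear recursion stays bounded if the products of its factors over an
interval are dominated by a summable function of the length of the interval. -/
lemma exists_forall_le_of_succ_le_of_prod_le_summable {γ u g : ℕ → ℝ} {M : ℝ}
    (hγ0 : ∀ n, 0 ≤ γ n) (hγ1 : ∀ n, γ n ≤ 1) (hM : 0 ≤ M) (hu0 : 0 ≤ u 0)
    (hu : ∀ n, u (n + 1) ≤ γ n * u n + M) (hg0 : ∀ n, 0 ≤ g n) (hg : Summable g)
    (hprod : ∀ m n, m ≤ n → ∏ k ∈ Finset.Ico m n, γ k ≤ g (n - m)) :
    ∃ B, ∀ n, u n ≤ B := by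
  refine ⟨u 0 + M * ∑' n, g n, fun n =>
    (le_prod_mul_add_sum_prod_of_succ_le hγ0 hu n).trans (add_le_add ?_ ?_)⟩
  · exact mul_le_of_le_one_left hu0
      (Finset.prod_le_one (fun k _ => hγ0 k) fun k _ => hγ1 k)
  · refine mul_le_mul_of_nonneg_left ?_ hM
    calc ∑ j ∈ Finset.range n, ∏ k ∈ Finset.Ico (j + 1) n, γ k
        ≤ ∑ j ∈ Finset.range n, g (n - 1 - j) := by
          refine Finset.sum_le_sum fun j hj => ?_
          rw [Nat.sub_sub, add_comm 1 j]
          exact hprod _ _ (Finset.mem_range.1 hj)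
      _ = ∑ j ∈ Finset.range n, g j := Finset.sum_range_reflect g n
      _ ≤ ∑' n, g n := hg.sum_le_tsum _ fun k _ => hg0 k

/-- **Infinity-case discussion of Corollary 2 (paper, appendix).**
Under the consecutive value approximation process, if the locality margins are
uniformly bounded (`L t ≤ L_max`, `d(π t, π (t+1)) ≤ D`) and the tail products
of the contraction factors decay polynomially,
`∏_{k=h₁}^{h₂} γ k ≤ C/(h₂−h₁+1)^{1+ε}`, then the generalized approximation
losses `f_{θ t}(π (t+1))` are uniformly bounded. -/
theorem pevfa_generalization_loss_bounded
    {Pol : Type*} [PseudoMetricSpace Pol] {E : Type*} [NormedAddCommGroup E]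
    {Θ : Type*} (V : Pol → E) (𝕍 : Θ → Pol → E)
    (f : Θ → Pol → ℝ) (hf : ∀ θ π, f θ π = ‖𝕍 θ π - V π‖)
    (π : ℕ → Pol) (θ : ℕ → Θ) (θinit : Θ) (γ L : ℕ → ℝ)
    (hγ0 : ∀ t, 0 ≤ γ t) (hγ1 : ∀ t, γ t < 1) (hL : ∀ t, 0 ≤ L t)
    (hcontract0 : f (θ 0) (π 0) ≤ γ 0 * f θinit (π 0))
    (hcontract : ∀ t : ℕ, 1 ≤ t → f (θ t) (π t) ≤ γ t * f (θ (t - 1)) (π t))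
    (hcont : ∀ t : ℕ, ∀ π' : Pol,
      |f (θ t) (π t) - f (θ t) π'| ≤ L t * dist (π t) π')
    (Lmax D : ℝ) (hLmax0 : 0 ≤ Lmax) (hD0 : 0 ≤ D)
    (hLmax : ∀ t, L t ≤ Lmax) (hD : ∀ t, dist (π t) (π (t + 1)) ≤ D)
    (C ε : ℝ) (hC : 0 < C) (hε : 0 < ε)
    (hdecay : ∀ h₁ h₂ : ℕ, h₁ ≤ h₂ →
      (∏ k ∈ Finset.Icc h₁ h₂, γ k) ≤
        C / ((h₂ - h₁ + 1 : ℕ) : ℝ) ^ (1 + ε)) :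
    ∃ B : ℝ, ∀ t : ℕ, f (θ t) (π (t + 1)) ≤ B := by
  have hstep (t : ℕ) : f (θ t) (π (t + 1)) ≤ f (θ t) (π t) + Lmax * D := by
    have hmargin : L t * dist (π t) (π (t + 1)) ≤ Lmax * D :=
      mul_le_mul (hLmax t) (hD t) dist_nonneg hLmax0
    linarith [(abs_le.1 (hcont t (π (t + 1)))).1]
  let u : ℕ → ℝ := fun n => Nat.casesOn n (f θinit (π 0)) fun t => f (θ t) (π (t + 1))
  let g : ℕ → ℝ := fun n => (if n = 0 then 1 else 0) + C / (n : ℝ) ^ (1 + ε)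
  have hu (n : ℕ) : u (n + 1) ≤ γ n * u n + Lmax * D := by
    refine (hstep n).trans (add_le_add_left ?_ _)
    cases n with
    | zero => exact hcontract0
    | succ n => exact hcontract (n + 1) (Nat.le_add_left 1 n)
  have hg : Summable g := by
    refine (hasSum_ite_eq 0 (1 : ℝ)).summable.add ?_
    simpa only [mul_one_div] using
      (Real.summable_one_div_nat_rpow.2 (lt_add_of_pos_right 1 hε)).mul_left C
  have hprod (m n : ℕ) (hmn : m ≤ n) : ∏ k ∈ Finset.Ico m n, γ k ≤ g (n - m) := by
    rcases hmn.eq_or_lt with rfl | hlt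
    · simp [g, Real.zero_rpow (by positivity : 1 + ε ≠ 0)]
    · obtain ⟨l, rfl⟩ := Nat.exists_eq_add_of_lt hlt
      have hIcc : Finset.Ico m (m + l + 1) = Finset.Icc m (m + l) := by
        ext k
        simp only [Finset.mem_Ico, Finset.mem_Icc, Nat.lt_succ_iff]
      have hlen : m + l + 1 - m = m + l - m + 1 := by lia
      rw [hIcc, hlen]
      simpa [g] using hdecay m (m + l) (Nat.le_add_right m l)
  obtain ⟨B, hB⟩ := exists_forall_le_of_succ_le_of_prod_le_summable hγ0
    (fun n => (hγ1 n).le) (mul_nonneg hLmax0 hD0)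
    (show 0 ≤ f θinit (π 0) from hf θinit (π 0) ▸ norm_nonneg _) hu
    (fun n => by positivity) hg hprod
  exact ⟨B, fun t => hB (t + 1)⟩
end
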